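/- arXiv:2306.13963 — 2 statements merged into one kernel-verified Lean document; each statement's English description precedes it below -/
import Mathlib

section
/- For every integer d ≥ 1, every α ∈ (0,2) and every x ∈ ℝ^d, the integral ∫_{ℝ^d} (1 − cos⟨z, x⟩)/‖z‖^{d+α} dz converges and equals C(d,α)·‖x‖^α, where C(d,α) = 2 π^{d/2} Γ(1 − α/2) / (α 2^α Γ((d+α)/2)), ⟨·,·⟩ is the Euclidean inner product, ‖·‖ the Euclidean norm and Γ the Gamma function. -/
open MeasureTheory
open scoped InnerProductSpace

lemma aux_gamma {a r : ℝ} (ha : 0 < a) (hr : 0 < r) :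
    ∫⁻ t in Set.Ioi (0 : ℝ), ENNReal.ofReal (t ^ (a - 1) * Real.exp (-(r * t)))
      = ENNReal.ofReal ((1 / r) ^ a * Real.Gamma a) := by
  have key := Real.integral_rpow_mul_exp_neg_mul_Ioi ha hr
  have hG := Real.Gamma_pos_of_pos ha
  have hint : IntegrableOn (fun t : ℝ => t ^ (a - 1) * Real.exp (-(r * t))) (Set.Ioi 0) :=
    .of_integral_ne_zero (by rw [key]; positivity)
  rw [← key, ofReal_integral_eq_lintegral_ofReal hint]
  rw [Filter.EventuallyLE, ae_restrict_iff' measurableSet_Ioi]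
  exact ae_of_all _ fun t (ht : 0 < t) => by simp only [Pi.zero_apply]; positivity

lemma aux_gamma_inv {a u : ℝ} (ha : 0 < a) (hu : 0 < u) :
    ∫⁻ t in Set.Ioi (0 : ℝ), ENNReal.ofReal (t ^ (-a - 1) * Real.exp (-(u / t)))
      = ENNReal.ofReal ((1 / u) ^ a * Real.Gamma a) := by
  have key := Real.integral_rpow_mul_exp_neg_mul_Ioi ha hu
  have hG := Real.Gamma_pos_of_pos ha
  rw [← integral_comp_rpow_Ioi _ (show (-1 : ℝ) ≠ 0 by norm_num)] at key
  have h2 : ∫ t in Set.Ioi (0 : ℝ), t ^ (-a - 1) * Real.exp (-(u / t))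
      = (1 / u) ^ a * Real.Gamma a := by
    rw [← key]
    refine setIntegral_congr_fun measurableSet_Ioi fun t ht => ?_
    have ht : 0 < t := ht
    simp only [abs_neg, abs_one, one_mul, smul_eq_mul]
    rw [← mul_assoc, ← Real.rpow_mul ht.le, ← Real.rpow_add ht, Real.rpow_neg_one, div_eq_mul_inv]
    congr 2
    ring
  have hint : IntegrableOn (fun t : ℝ => t ^ (-a - 1) * Real.exp (-(u / t))) (Set.Ioi 0) :=
    .of_integral_ne_zero (by rw [h2]; positivity)
  rw [← h2, ofReal_integral_eq_lintegral_ofReal hint]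
  rw [Filter.EventuallyLE, ae_restrict_iff' measurableSet_Ioi]
  exact ae_of_all _ fun t (ht : 0 < t) => by simp only [Pi.zero_apply]; positivity

lemma aux_exp {t r : ℝ} (ht : 0 < t) (hr : 0 ≤ r) :
    ∫⁻ u in Set.Ioc (0 : ℝ) r, ENNReal.ofReal (t⁻¹ * Real.exp (-(u / t)))
      = ENNReal.ofReal (1 - Real.exp (-(r / t))) := by
  have h : ∫ u in (0 : ℝ)..r, t⁻¹ * Real.exp (-(u / t)) = 1 - Real.exp (-(r / t)) := by
    rw [intervalIntegral.integral_eq_sub_of_hasDerivAt (f := fun u => - Real.exp (-(u / t)))]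
    · simp; ring
    · intro u _
      have := ((((hasDerivAt_id u).div_const t).neg).exp).neg
      convert! this using 1
      simp; ring
    · apply Continuous.intervalIntegrable
      fun_prop
  rw [← h, intervalIntegral.integral_of_le hr, ofReal_integral_eq_lintegral_ofReal]
  · apply Continuous.integrableOn_Ioc
    fun_prop
  · exact ae_of_all _ fun u => by simp only [Pi.zero_apply]; positivity

lemma aux_pow {b r : ℝ} (hb : 0 < b) (hr : 0 ≤ r) :
    ∫⁻ u in Set.Ioc (0 : ℝ) r, ENNReal.ofReal (u ^ (b - 1))
      = ENNReal.ofReal (r ^ b / b) := by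
  have h : ∫ u in (0 : ℝ)..r, u ^ (b - 1) = r ^ b / b := by
    rw [integral_rpow (Or.inl (by linarith))]
    simp [Real.zero_rpow hb.ne']
  rw [← h, intervalIntegral.integral_of_le hr, ofReal_integral_eq_lintegral_ofReal]
  · exact (intervalIntegral.intervalIntegrable_rpow' (by linarith)).1
  · rw [Filter.EventuallyLE, ae_restrict_iff' measurableSet_Ioc]
    exact ae_of_all _ fun u hu => by
      have := hu.1
      simp only [Pi.zero_apply]; positivity

lemma aux_C {b r : ℝ} (hb : 0 < b) (hb1 : b < 1) (hr : 0 ≤ r) :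
    ∫⁻ t in Set.Ioi (0 : ℝ), ENNReal.ofReal (t ^ (b - 1) * (1 - Real.exp (-(r / t))))
      = ENNReal.ofReal (Real.Gamma (1 - b) * (r ^ b / b)) := by
  have hG := Real.Gamma_pos_of_pos (show 0 < 1 - b by linarith)
  calc
    _ = ∫⁻ t in Set.Ioi (0 : ℝ), ∫⁻ u in Set.Ioc (0 : ℝ) r,
          ENNReal.ofReal (t ^ (-(1 - b) - 1) * Real.exp (-(u / t))) := by
      refine setLIntegral_congr_fun measurableSet_Ioi fun t ht => ?_
      have ht : 0 < t := ht
      rw [ENNReal.ofReal_mul (by positivity), ← aux_exp ht hr, ← lintegral_const_mul _ (by fun_prop)]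
      refine lintegral_congr fun u => ?_
      rw [← ENNReal.ofReal_mul (by positivity), ← mul_assoc, ← Real.rpow_neg_one, ← Real.rpow_add ht]
      congr 3
      ring
    _ = ∫⁻ u in Set.Ioc (0 : ℝ) r, ∫⁻ t in Set.Ioi (0 : ℝ),
          ENNReal.ofReal (t ^ (-(1 - b) - 1) * Real.exp (-(u / t))) := by
      apply lintegral_lintegral_swap
      apply Measurable.aemeasurable
      unfold Function.uncurry
      fun_prop
    _ = ∫⁻ u in Set.Ioc (0 : ℝ) r,
          ENNReal.ofReal (Real.Gamma (1 - b)) * ENNReal.ofReal (u ^ (b - 1)) := by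
      refine setLIntegral_congr_fun measurableSet_Ioc fun u hu => ?_
      rw [aux_gamma_inv (by linarith) hu.1, ← ENNReal.ofReal_mul hG.le, mul_comm, one_div,
        Real.inv_rpow hu.1.le, ← Real.rpow_neg hu.1.le, neg_sub]
    _ = _ := by
      rw [lintegral_const_mul _ (by fun_prop), aux_pow hb hr, ENNReal.ofReal_mul hG.le]

lemma aux_D {d : ℕ} (x : EuclideanSpace ℝ (Fin d)) {t : ℝ} (ht : 0 < t) :
    ∫⁻ z : EuclideanSpace ℝ (Fin d),
        ENNReal.ofReal (Real.exp (-(‖z‖ ^ 2 * t)) * (1 - Real.cos ⟪z, x⟫_ℝ))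
      = ENNReal.ofReal ((Real.pi / t) ^ ((d : ℝ) / 2) *
          (1 - Real.exp (-(‖x‖ ^ 2 / 4 / t)))) := by
  have htc : 0 < (t : ℂ).re := by simpa
  have i0 := GaussianFourier.integrable_cexp_neg_mul_sq_norm_add htc 0 x
  have i1 := GaussianFourier.integrable_cexp_neg_mul_sq_norm_add htc Complex.I x
  have e0 := GaussianFourier.integral_cexp_neg_mul_sq_norm_add htc 0 x
  have e1 := GaussianFourier.integral_cexp_neg_mul_sq_norm_add htc Complex.I x
  have hre : (fun z : EuclideanSpace ℝ (Fin d) =>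
      Real.exp (-(‖z‖ ^ 2 * t)) * (1 - Real.cos ⟪z, x⟫_ℝ)) = fun z =>
      (Complex.exp (-t * ‖z‖ ^ 2 + 0 * ⟪x, z⟫_ℝ)
        - Complex.exp (-t * ‖z‖ ^ 2 + Complex.I * ⟪x, z⟫_ℝ)).re := by
    funext z
    rw [Complex.sub_re, Complex.exp_re, Complex.exp_re, real_inner_comm]
    have h1 : (-(t:ℂ) * ‖z‖ ^ 2) = ((-(‖z‖ ^ 2 * t) : ℝ) : ℂ) := by push_cast; ring
    rw [h1]
    generalize -(‖z‖ ^ 2 * t) = q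
    simp
    ring
  have hI : Integrable (fun z : EuclideanSpace ℝ (Fin d) =>
      Real.exp (-(‖z‖ ^ 2 * t)) * (1 - Real.cos ⟪z, x⟫_ℝ)) := by
    rw [hre]
    exact (i0.sub i1).re
  rw [← ofReal_integral_eq_lintegral_ofReal hI]
  · congr 1
    rw [hre]
    have := integral_re (i0.sub i1)
    simp only [Pi.sub_apply, RCLike.re_eq_complex_re] at this
    rw [this, integral_sub i0 i1, e0, e1]
    have h2 : ((Real.pi : ℂ) / t) ^ ((Module.finrank ℝ (EuclideanSpace ℝ (Fin d)) : ℂ) / 2)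
        = (((Real.pi / t) ^ ((d : ℝ) / 2) : ℝ) : ℂ) := by
      rw [Complex.ofReal_cpow (by positivity)]
      simp
    have h3 : Complex.I ^ 2 * (‖x‖ : ℂ) ^ 2 / (4 * t) = ((-(‖x‖ ^ 2 / 4 / t) : ℝ) : ℂ) := by
      rw [Complex.I_sq]; push_cast; field_simp
    rw [h2, h3, ← Complex.ofReal_exp]
    have h4 : (0 : ℂ) ^ 2 * (‖x‖ : ℂ) ^ 2 / (4 * t) = 0 := by simp
    rw [h4, Complex.exp_zero, mul_one, ← Complex.ofReal_mul, ← Complex.ofReal_sub,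
      Complex.ofReal_re]
    ring
  · exact ae_of_all _ fun z => mul_nonneg (Real.exp_pos _).le
      (by linarith [Real.cos_le_one ⟪z, x⟫_ℝ])

lemma aux_main (d : ℕ) (α : ℝ) (hα0 : 0 < α) (hα2 : α < 2)
    (x : EuclideanSpace ℝ (Fin d)) :
    ∫⁻ z : EuclideanSpace ℝ (Fin d),
        ENNReal.ofReal ((1 - Real.cos ⟪z, x⟫_ℝ) / ‖z‖ ^ ((d : ℝ) + α))
      = ENNReal.ofReal ((2 * Real.pi ^ ((d : ℝ) / 2) * Real.Gamma (1 - α / 2)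
          / (α * (2 : ℝ) ^ α * Real.Gamma (((d : ℝ) + α) / 2))) * ‖x‖ ^ α) := by
  have hs : 0 < ((d : ℝ) + α) / 2 := by positivity
  have hG := Real.Gamma_pos_of_pos hs
  have hcos : ∀ z : EuclideanSpace ℝ (Fin d), 0 ≤ 1 - Real.cos ⟪z, x⟫_ℝ :=
    fun z => by linarith [Real.cos_le_one ⟪z, x⟫_ℝ]
  set s := ((d : ℝ) + α) / 2 with hsdef
  calc
    _ = ∫⁻ z : EuclideanSpace ℝ (Fin d), ∫⁻ t in Set.Ioi (0 : ℝ),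
          ENNReal.ofReal ((Real.Gamma s)⁻¹ * (1 - Real.cos ⟪z, x⟫_ℝ)) *
          ENNReal.ofReal (t ^ (s - 1) * Real.exp (-(‖z‖ ^ 2 * t))) := by
      refine lintegral_congr fun z => ?_
      rw [lintegral_const_mul _ (by fun_prop)]
      rcases eq_or_ne z 0 with rfl | hz
      · simp
      have hz : 0 < ‖z‖ := norm_pos_iff.mpr hz
      rw [aux_gamma hs (by positivity), ← ENNReal.ofReal_mul (mul_nonneg (by positivity) (hcos z))]
      congr 1
      rw [one_div, Real.inv_rpow (by positivity), ← Real.rpow_natCast, ← Real.rpow_mul hz.le]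
      rw [show ((2 : ℕ) : ℝ) * s = d + α by rw [hsdef]; push_cast; ring]
      field_simp
    _ = ∫⁻ t in Set.Ioi (0 : ℝ), ∫⁻ z : EuclideanSpace ℝ (Fin d),
          ENNReal.ofReal ((Real.Gamma s)⁻¹ * (1 - Real.cos ⟪z, x⟫_ℝ)) *
          ENNReal.ofReal (t ^ (s - 1) * Real.exp (-(‖z‖ ^ 2 * t))) := by
      apply lintegral_lintegral_swap
      apply Measurable.aemeasurable
      unfold Function.uncurry
      fun_prop
    _ = ∫⁻ t in Set.Ioi (0 : ℝ), ENNReal.ofReal ((Real.Gamma s)⁻¹ * Real.pi ^ ((d : ℝ) / 2)) *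
          ENNReal.ofReal (t ^ (α / 2 - 1) * (1 - Real.exp (-(‖x‖ ^ 2 / 4 / t)))) := by
      refine setLIntegral_congr_fun measurableSet_Ioi fun t ht => ?_
      have ht : 0 < t := ht
      trans ∫⁻ z : EuclideanSpace ℝ (Fin d), ENNReal.ofReal ((Real.Gamma s)⁻¹ * t ^ (s - 1)) *
        ENNReal.ofReal (Real.exp (-(‖z‖ ^ 2 * t)) * (1 - Real.cos ⟪z, x⟫_ℝ))
      · refine lintegral_congr fun z => ?_
        rw [← ENNReal.ofReal_mul (mul_nonneg (by positivity) (hcos z)),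
          ← ENNReal.ofReal_mul (by positivity)]
        congr 1
        ring
      rw [lintegral_const_mul _ (by fun_prop), aux_D x ht, ← ENNReal.ofReal_mul (by positivity),
        ← ENNReal.ofReal_mul (by positivity)]
      congr 1
      rw [Real.div_rpow Real.pi_pos.le ht.le,
        show α / 2 - 1 = (s - 1) - (d : ℝ) / 2 by rw [hsdef]; ring, Real.rpow_sub ht (s - 1)]
      ring
    _ = _ := by
      rw [lintegral_const_mul _ (by fun_prop), aux_C (by linarith) (by linarith) (by positivity),
        ← ENNReal.ofReal_mul (by positivity)]
      congr 1
      have : (‖x‖ ^ 2 / 4) ^ (α / 2) = ‖x‖ ^ α / 2 ^ α := by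
        rw [show ‖x‖ ^ 2 / 4 = (‖x‖ / 2) ^ (2 : ℝ) by rw [Real.rpow_two]; ring,
          ← Real.rpow_mul (by positivity), Real.div_rpow (by positivity) (by positivity)]
        congr 2 <;> ring
      rw [this]
      field_simp

/-- Lemma 1 (Székely et al. 2007): for every `d ≥ 1`, `α ∈ (0,2)` and `x ∈ ℝ^d`, the
integral `∫_{ℝ^d} (1 − cos⟨z,x⟩)/‖z‖^{d+α} dz` converges and equals `C(d,α)·‖x‖^α` with
`C(d,α) = 2 π^{d/2} Γ(1 − α/2) / (α 2^α Γ((d+α)/2))`. -/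
theorem stmt_0 (d : ℕ) (hd : 1 ≤ d) (α : ℝ) (hα0 : 0 < α) (hα2 : α < 2)
    (x : EuclideanSpace ℝ (Fin d)) :
    Integrable (fun z : EuclideanSpace ℝ (Fin d) =>
      (1 - Real.cos ⟪z, x⟫_ℝ) / ‖z‖ ^ ((d : ℝ) + α)) ∧
    (∫ z : EuclideanSpace ℝ (Fin d), (1 - Real.cos ⟪z, x⟫_ℝ) / ‖z‖ ^ ((d : ℝ) + α))
      = (2 * Real.pi ^ ((d : ℝ) / 2) * Real.Gamma (1 - α / 2)
          / (α * (2 : ℝ) ^ α * Real.Gamma (((d : ℝ) + α) / 2))) * ‖x‖ ^ α := by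

  have hG1 := Real.Gamma_pos_of_pos (show 0 < 1 - α / 2 by linarith)
  have hG2 := Real.Gamma_pos_of_pos (show 0 < ((d : ℝ) + α) / 2 by positivity)
  have hm : AEStronglyMeasurable (fun z : EuclideanSpace ℝ (Fin d) =>
      (1 - Real.cos ⟪z, x⟫_ℝ) / ‖z‖ ^ ((d : ℝ) + α)) := by
    apply Measurable.aestronglyMeasurable
    fun_prop
  have hn : 0 ≤ᵐ[volume] (fun z : EuclideanSpace ℝ (Fin d) =>
      (1 - Real.cos ⟪z, x⟫_ℝ) / ‖z‖ ^ ((d : ℝ) + α)) :=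
    ae_of_all _ fun z => div_nonneg (by linarith [Real.cos_le_one ⟪z, x⟫_ℝ]) (by positivity)
  have hmain := aux_main d α hα0 hα2 x
  constructor
  · rw [← lintegral_ofReal_ne_top_iff_integrable hm hn, hmain]
    exact ENNReal.ofReal_ne_top
  · rw [integral_eq_lintegral_of_nonneg_ae hn hm, hmain, ENNReal.toReal_ofReal (by positivity)]
end

section
/- Let X be an integrable real random variable and Y a real random variable, defined on the same probability space. Then E[X | Y] = E[X] almost surely if and only if for every v ∈ ℝ, E[X·e^{ivY}] = E[X]·E[e^{ivY}]. -/
open MeasureTheory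

lemma aux_charFun {Ω : Type*} [MeasurableSpace Ω] (μ : Measure Ω)
    (Z Y : Ω → ℝ) (hZ : Integrable Z μ) (hY : Measurable Y) (v : ℝ) :
    charFun ((μ.withDensity (fun ω => ENNReal.ofReal (Z ω))).map Y) v
      = ∫ ω, ((max (Z ω) 0 : ℝ) : ℂ) * Complex.exp (Complex.I * ((v * Y ω : ℝ) : ℂ)) ∂μ := by
  rw [charFun_apply_real, integral_map hY.aemeasurable (by fun_prop),
    integral_withDensity_eq_integral_toReal_smul₀ (by have := hZ.aemeasurable; fun_prop)
      (by simp)]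
  congr 1
  ext ω
  rw [ENNReal.toReal_ofReal', Complex.real_smul]
  push_cast
  ring_nf

lemma aux_set {Ω : Type*} [MeasurableSpace Ω] (μ : Measure Ω)
    (Z Y : Ω → ℝ) (hZ : Integrable Z μ) (hY : Measurable Y) {s : Set ℝ} (hs : MeasurableSet s) :
    ((μ.withDensity (fun ω => ENNReal.ofReal (Z ω))).map Y) s
      = ENNReal.ofReal (∫ ω in Y ⁻¹' s, max (Z ω) 0 ∂μ) := by
  rw [Measure.map_apply hY hs, withDensity_apply _ (hY hs),
    ofReal_integral_eq_lintegral_ofReal hZ.pos_part.integrableOn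
      (Filter.Eventually.of_forall fun _ => le_max_right _ _)]
  simp

lemma aux_int {Ω : Type*} [MeasurableSpace Ω] (μ : Measure Ω)
    (Z Y : Ω → ℝ) (hZ : Integrable Z μ) (hY : Measurable Y) (v : ℝ) :
    Integrable (fun ω => (Z ω : ℂ) * Complex.exp (Complex.I * ((v * Y ω : ℝ) : ℂ))) μ := by
  refine hZ.ofReal.mul_bdd (c := 1) (by fun_prop) (Filter.Eventually.of_forall fun ω => ?_)
  rw [mul_comm, Complex.norm_exp_ofReal_mul_I]

lemma aux_main_s9 {Ω : Type*} [MeasurableSpace Ω] (μ : Measure Ω) [IsProbabilityMeasure μ]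
    (Z Y : Ω → ℝ) (hZ : Integrable Z μ) (hY : Measurable Y) :
    (∀ s : Set ℝ, MeasurableSet s → ∫ ω in Y ⁻¹' s, Z ω ∂μ = 0) ↔
      ∀ v : ℝ, ∫ ω, (Z ω : ℂ) * Complex.exp (Complex.I * ((v * Y ω : ℝ) : ℂ)) ∂μ = 0 := by
  have hd : ∀ ω, Z ω = max (Z ω) 0 - max (-Z ω) 0 := fun ω => by
    rcases le_total (Z ω) 0 with h | h
    · rw [max_eq_right h, max_eq_left (by linarith)]; ring
    · rw [max_eq_left h, max_eq_right (by linarith)]; ring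
  have hN : Integrable (fun ω => -Z ω) μ := hZ.neg
  have f1 := isFiniteMeasure_withDensity_ofReal hZ.2
  have f2 := isFiniteMeasure_withDensity_ofReal hN.2
  have key1 : (∀ s : Set ℝ, MeasurableSet s → ∫ ω in Y ⁻¹' s, Z ω ∂μ = 0) ↔
      (μ.withDensity (fun ω => ENNReal.ofReal (Z ω))).map Y
        = (μ.withDensity (fun ω => ENNReal.ofReal (-Z ω))).map Y := by
    rw [Measure.ext_iff]
    refine forall₂_congr fun s hs => ?_
    have n1 : 0 ≤ ∫ ω in Y ⁻¹' s, max (Z ω) 0 ∂μ := integral_nonneg fun _ => le_max_right _ _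
    have n2 : 0 ≤ ∫ ω in Y ⁻¹' s, max (-Z ω) 0 ∂μ := integral_nonneg fun _ => le_max_right _ _
    rw [aux_set μ Z Y hZ hY hs, aux_set μ (fun ω => -Z ω) Y hN hY hs,
      ENNReal.ofReal_eq_ofReal_iff n1 n2,
      ← sub_eq_zero (a := ∫ ω in Y ⁻¹' s, max (Z ω) 0 ∂μ),
      ← integral_sub hZ.pos_part.integrableOn hN.pos_part.integrableOn]
    simp_rw [← hd]
  have key2 : ∀ v : ℝ, ∫ ω, (Z ω : ℂ) * Complex.exp (Complex.I * ((v * Y ω : ℝ) : ℂ)) ∂μ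
      = charFun ((μ.withDensity (fun ω => ENNReal.ofReal (Z ω))).map Y) v
        - charFun ((μ.withDensity (fun ω => ENNReal.ofReal (-Z ω))).map Y) v := by
    intro v
    rw [aux_charFun μ Z Y hZ hY, aux_charFun μ (fun ω => -Z ω) Y hN hY,
      ← integral_sub (aux_int μ _ Y hZ.pos_part hY v) (aux_int μ _ Y hN.pos_part hY v)]
    congr 1
    ext ω
    rw [← sub_mul, ← Complex.ofReal_sub, ← hd]
  rw [key1]
  simp_rw [key2, sub_eq_zero]
  exact ⟨fun h v => by rw [h], fun h => Measure.ext_of_charFun (funext h)⟩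

/-- Bierens (1982) characterization: for an integrable real random variable `X` and a real
random variable `Y`, `E[X | Y] = E[X]` almost surely iff for every `v ∈ ℝ`,
`E[X·e^{ivY}] = E[X]·E[e^{ivY}]`. -/
theorem stmt_9 {Ω : Type*} [MeasurableSpace Ω] (μ : Measure Ω) [IsProbabilityMeasure μ]
    (X Y : Ω → ℝ) (hX : Integrable X μ) (hY : Measurable Y) :
    (μ[X | MeasurableSpace.comap Y (inferInstance : MeasurableSpace ℝ)]
        =ᵐ[μ] fun _ => ∫ ω, X ω ∂μ) ↔
      ∀ v : ℝ, ∫ ω, (X ω : ℂ) * Complex.exp (Complex.I * ((v * Y ω : ℝ) : ℂ)) ∂μ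
        = ((∫ ω, X ω ∂μ : ℝ) : ℂ) * ∫ ω, Complex.exp (Complex.I * ((v * Y ω : ℝ) : ℂ)) ∂μ := by
  generalize hc : ∫ ω, X ω ∂μ = c
  have hci : Integrable (fun _ : Ω => c) μ := integrable_const c
  have hm : MeasurableSpace.comap Y (inferInstance : MeasurableSpace ℝ) ≤ _ := hY.comap_le
  have h2 := aux_main_s9 μ (fun ω => X ω - c) Y (hX.sub hci) hY
  have h3 : ∀ v : ℝ, ∫ ω, ((X ω - c : ℝ) : ℂ) * Complex.exp (Complex.I * ((v * Y ω : ℝ) : ℂ)) ∂μ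
      = ∫ ω, (X ω : ℂ) * Complex.exp (Complex.I * ((v * Y ω : ℝ) : ℂ)) ∂μ
        - (c : ℂ) * ∫ ω, Complex.exp (Complex.I * ((v * Y ω : ℝ) : ℂ)) ∂μ := by
    intro v
    rw [← integral_const_mul, ← integral_sub (aux_int μ X Y hX hY v) (aux_int μ _ Y hci hY v)]
    congr 1
    ext ω
    rw [← sub_mul, ← Complex.ofReal_sub]
  simp_rw [h3, sub_eq_zero] at h2
  rw [← h2]
  have h4 : ∀ s : Set Ω, ∫ ω in s, (X ω - c) ∂μ = ∫ ω in s, X ω ∂μ - ∫ ω in s, c ∂μ :=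
    fun s => integral_sub hX.integrableOn hci.integrableOn
  simp_rw [h4, sub_eq_zero]
  constructor
  · intro h s hs
    rw [← setIntegral_condExp hm hX ⟨s, hs, rfl⟩]
    exact integral_congr_ae (ae_restrict_of_ae h)
  · intro h
    refine (ae_eq_condExp_of_forall_setIntegral_eq hm hX (fun _ _ _ => hci.integrableOn) ?_
      aestronglyMeasurable_const).symm
    rintro _ ⟨s, hs, rfl⟩ _
    exact (h s hs).symm
end
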